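/- A finite group G is supersolvable if and only if every subgroup of G has the property CLT, i.e., for every subgroup H of G and every divisor m of |H| there exists a subgroup of H of order m. -/

import Mathlib

open Pointwise

/-- A group is supersolvable if it possesses a finite normal series
`⊥ = s 0 ≤ s 1 ≤ … ≤ s n = ⊤` with all terms normal in the whole group and all
successive factor groups cyclic (equivalently, each `s (i+1)` is generated by
`s i` together with a single element). -/
def IsSupersolvable (G : Type*) [Group G] : Prop :=
  ∃ (n : ℕ) (s : Fin (n + 1) → Subgroup G),
    s 0 = ⊥ ∧ s (Fin.last n) = ⊤ ∧
    (∀ i, (s i).Normal) ∧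
    (∀ i : Fin n, s i.castSucc ≤ s i.succ) ∧
    (∀ i : Fin n, ∃ x : G, s i.succ = s i.castSucc ⊔ Subgroup.closure {x})

theorem ss_surj {G H : Type*} [Group G] [Group H] (f : G →* H) (hf : Function.Surjective f)
    (h : IsSupersolvable G) : IsSupersolvable H := by
  obtain ⟨n, s, h0, h1, h2, h3, h4⟩ := h
  refine ⟨n, fun i => (s i).map f, by simp [h0], ?_, fun i => (h2 i).map f hf,
    fun i => Subgroup.map_mono (h3 i), fun i => ?_⟩
  · simp only [h1]; exact Subgroup.map_top_of_surjective f hf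
  · obtain ⟨x, hx⟩ := h4 i
    refine ⟨f x, ?_⟩
    simp only [hx, Subgroup.map_sup, MonoidHom.map_closure, Set.image_singleton]

theorem ss_ext {G : Type*} [Group G] (N : Subgroup G) [hN : N.Normal] (hc : IsCyclic N)
    (h : IsSupersolvable (G ⧸ N)) : IsSupersolvable G := by
  obtain ⟨n, s, h0, h1, h2, h3, h4⟩ := h
  refine ⟨n + 1, Fin.cons ⊥ (fun i => (s i).comap (QuotientGroup.mk' N)), rfl, ?_, ?_, ?_, ?_⟩
  · rw [← Fin.succ_last, Fin.cons_succ, h1, Subgroup.comap_top]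
  · intro i
    refine Fin.cases ?_ (fun i => ?_) i
    · rw [Fin.cons_zero]; infer_instance
    · rw [Fin.cons_succ]; exact (h2 i).comap _
  · intro i
    refine Fin.cases ?_ (fun i => ?_) i
    · simp
    · rw [← Fin.succ_castSucc, Fin.cons_succ, Fin.cons_succ]
      exact Subgroup.comap_mono (h3 i)
  · intro i
    refine Fin.cases ?_ (fun i => ?_) i
    · obtain ⟨x, hx⟩ := (Subgroup.isCyclic_iff_exists_zpowers_eq_top N).1 hc
      refine ⟨x, ?_⟩
      rw [Fin.cons_succ, Fin.castSucc_zero, Fin.cons_zero, h0, MonoidHom.comap_bot,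
        QuotientGroup.ker_mk', bot_sup_eq, ← Subgroup.zpowers_eq_closure, hx]
    · obtain ⟨x, hx⟩ := h4 i
      obtain ⟨y, rfl⟩ := QuotientGroup.mk'_surjective N x
      refine ⟨y, ?_⟩
      rw [← Fin.succ_castSucc, Fin.cons_succ, Fin.cons_succ, hx,
        ← Set.image_singleton, ← MonoidHom.map_closure,
        ← Subgroup.map_comap_eq_self_of_surjective (QuotientGroup.mk'_surjective N) (s i.castSucc),
        ← Subgroup.map_sup, Subgroup.comap_map_eq, Subgroup.comap_map_eq,
        QuotientGroup.ker_mk']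
      have : N ≤ (s i.castSucc).comap (QuotientGroup.mk' N) := by
        intro z hz
        rw [Subgroup.mem_comap]
        have : QuotientGroup.mk' N z = 1 := by simpa using hz
        rw [this]; exact one_mem _
      rw [sup_eq_left.2 this, sup_eq_left.2 (this.trans le_sup_left)]

theorem ss_prime {G : Type*} [Group G] [Finite G] (h : IsSupersolvable G)
    (Z : Subgroup G) [hZ : Z.Normal] (hZ0 : Z ≠ ⊥) :
    ∃ Q : Subgroup G, Q ≤ Z ∧ Q.Normal ∧ (Nat.card Q).Prime := by
  obtain ⟨n, s, h0, h1, h2, h3, h4⟩ := h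
  have key : ∃ j : Fin n, s j.castSucc ⊓ Z = ⊥ ∧ s j.succ ⊓ Z ≠ ⊥ := by
    by_contra! hcon
    have : ∀ i, s i ⊓ Z = ⊥ := by
      intro i
      induction i using Fin.induction with
      | zero => simp [h0]
      | succ i ih => exact hcon i ih
    apply hZ0
    simpa [h1] using this (Fin.last n)
  obtain ⟨j, hj0, hj1⟩ := key
  obtain ⟨x, hx⟩ := h4 j
  have := h2 j.castSucc
  have := h2 j.succ
  let D := s j.succ ⊓ Z
  have hDn : D.Normal := inferInstance
  let π := QuotientGroup.mk' (s j.castSucc)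
  have hmem : ∀ d : D, π d ∈ Subgroup.zpowers (π x) := by
    rintro ⟨d, hd⟩
    have h5 : π d ∈ (s j.succ).map π := Subgroup.mem_map_of_mem _ hd.1
    rw [hx, Subgroup.map_sup, MonoidHom.map_closure, Set.image_singleton,
      ← Subgroup.zpowers_eq_closure] at h5
    simpa [π] using h5
  let φ : D →* Subgroup.zpowers (π x) := (π.comp D.subtype).codRestrict _ hmem
  have hφ : Function.Injective φ := by
    rw [injective_iff_map_eq_one]
    rintro ⟨d, hd⟩ h6
    have h7 : π d = 1 := congrArg Subtype.val h6
    have h8 : d ∈ s j.castSucc := by simpa [π] using h7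
    have h9 : d ∈ s j.castSucc ⊓ Z := ⟨h8, hd.2⟩
    rw [hj0] at h9
    exact Subtype.ext (by simpa using h9)
  have hcyc : IsCyclic D := isCyclic_of_injective φ hφ
  obtain ⟨d, hd⟩ := (Subgroup.isCyclic_iff_exists_zpowers_eq_top D).1 hcyc
  have hDcard : Nat.card D ≠ 1 := by
    intro h; exact hj1 (Subgroup.card_eq_one.1 h)
  obtain ⟨q, hq, hqd⟩ := Nat.exists_prime_and_dvd hDcard
  have := Fact.mk hq
  obtain ⟨g, hg⟩ := exists_prime_orderOf_dvd_card' q hqd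
  have hgZ : Subgroup.zpowers (g : G) ≤ D := by simp
  refine ⟨Subgroup.zpowers (g : G), hgZ.trans inf_le_right, ?_, ?_⟩
  · constructor
    intro a ha y
    have hdD : d ∈ D := hd ▸ Subgroup.mem_zpowers d
    have h10 : y * d * y⁻¹ ∈ D := hDn.conj_mem d hdD y
    rw [← hd] at h10
    obtain ⟨k, hk⟩ := h10
    have haD := hgZ ha
    rw [← hd] at haD
    obtain ⟨l, rfl⟩ := haD
    have : y * d ^ l * y⁻¹ = (d ^ l) ^ k := by
      rw [← conj_zpow, ← hk]; simp only [← zpow_mul, mul_comm]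
    simp only [this]
    exact Subgroup.zpow_mem _ ha k
  · rw [Nat.card_zpowers, Subgroup.orderOf_coe, hg]; exact hq

theorem eq_top_of_lt_of_index_prime {G : Type*} [Group G] {M K : Subgroup G}
    (hM : M.index.Prime) (h : M ≤ K) (hne : ¬ K ≤ M) : K = ⊤ := by
  rcases (Nat.dvd_prime hM).1 (Subgroup.index_dvd_of_le h) with h1 | h1
  · exact Subgroup.index_eq_one.1 h1
  · exfalso
    have h2 := Subgroup.relIndex_mul_index h
    rw [h1] at h2
    have h3 : M.relIndex K = 1 := Nat.eq_of_mul_eq_mul_right hM.pos (by rw [h2, one_mul])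
    exact hne (Subgroup.relIndex_eq_one.1 h3)

theorem card_quot_lt {G : Type*} [Group G] [Finite G] (Q : Subgroup G)
    (hQ : (Nat.card Q).Prime) : Nat.card (G ⧸ Q) < Nat.card G := by
  rw [Subgroup.card_eq_card_quotient_mul_card_subgroup Q]
  exact lt_mul_of_one_lt_right Nat.card_pos hQ.one_lt

theorem ss_of_sup.{u} (p : ℕ) [Fact p.Prime] (n : ℕ) : ∀ (G : Type u) [Group G] [Finite G],
    Nat.card G = n →
    ∀ M R : Subgroup G, IsSupersolvable M → M.index.Prime → R.Normal → IsPGroup p R →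
      M ⊔ R = ⊤ → IsSupersolvable G := by
  induction n using Nat.strong_induction_on with
  | _ n ih =>
  intro G _ _ hn M R hM hMi hR hp hsup
  let A := (Subgroup.center R).map R.subtype
  have hAn : A.Normal := inferInstance
  have hR0 : Nontrivial R := by
    rw [Subgroup.nontrivial_iff_ne_bot]
    rintro rfl
    rw [sup_bot_eq] at hsup
    rw [hsup, Subgroup.index_top] at hMi
    exact Nat.not_prime_one hMi
  have hc := hp.center_nontrivial
  have hA0 : A ≠ ⊥ := by
    rw [Subgroup.nontrivial_iff_ne_bot] at hc
    intro h
    exact hc ((Subgroup.map_eq_bot_iff_of_injective _ R.subtype_injective).1 h)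
  by_cases hd : Disjoint A M
  · have hAM : M ⊔ A = ⊤ := by
      apply eq_top_of_lt_of_index_prime hMi le_sup_left
      intro h
      exact hA0 (hd.eq_bot_of_le (le_sup_right.trans h))
    have hcompl : Subgroup.IsComplement' A M := by
      apply Subgroup.isComplement'_of_disjoint_and_mul_eq_univ hd
      rw [← Subgroup.normal_mul, sup_comm, hAM, Subgroup.coe_top]
    have hAc : Nat.card A = M.index := hcompl.index_eq_card.symm
    have := Fact.mk hMi
    refine ss_ext A (isCyclic_of_prime_card hAc) ?_
    refine ss_surj ((QuotientGroup.mk' A).comp M.subtype) ?_ hM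
    rw [← MonoidHom.range_eq_top, MonoidHom.range_comp, Subgroup.range_subtype]
    have := congrArg (Subgroup.map (QuotientGroup.mk' A)) hAM
    rw [Subgroup.map_sup, Subgroup.map_top_of_surjective _ (QuotientGroup.mk'_surjective A)] at this
    simpa using this
  · have hZ0 : A.subgroupOf M ≠ ⊥ := by
      rwa [Ne, Subgroup.subgroupOf_eq_bot]
    obtain ⟨Q0, hQ0Z, hQ0n, hQ0p⟩ := ss_prime hM (A.subgroupOf M) hZ0
    let Q := Q0.map M.subtype
    have hQM : Q ≤ M := Subgroup.map_subtype_le Q0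
    have hQA : Q ≤ A := by
      rintro _ ⟨x, hx, rfl⟩
      exact hQ0Z hx
    have hQcard : (Nat.card Q).Prime := by
      rw [Subgroup.card_subtype]; exact hQ0p
    have hQn : Q.Normal := by
      rw [← Subgroup.normalizer_eq_top_iff, ← top_le_iff, ← hsup, sup_le_iff]
      constructor
      · rw [← Subgroup.normal_subgroupOf_iff_le_normalizer hQM]
        have : Q.subgroupOf M = Q0 := Subgroup.comap_map_eq_self_of_injective M.subtype_injective Q0
        rw [this]; exact hQ0n
      · intro r hr
        rw [Subgroup.mem_normalizer_iff]
        have hcomm : ∀ a ∈ A, r * a * r⁻¹ = a := by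
          rintro _ ⟨a, ha, rfl⟩
          have := congrArg Subtype.val (Subgroup.mem_center_iff.1 ha ⟨r, hr⟩)
          simp only [Subgroup.coe_mul] at this
          simp [this]
        intro h
        constructor
        · intro hh
          rw [hcomm h (hQA hh)]; exact hh
        · intro hh
          have h1 := hcomm _ (hQA hh)
          have h2 : r * h * r⁻¹ = h := by
            have := congrArg (fun t => r⁻¹ * t * r) h1
            simpa [mul_assoc] using this
          rwa [h2] at hh
    have hs := QuotientGroup.mk'_surjective Q
    have := Fact.mk hQcard
    refine ss_ext Q (isCyclic_of_prime_card rfl) ?_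
    refine ih _ (hn ▸ card_quot_lt Q hQcard) (G ⧸ Q) rfl (M.map (QuotientGroup.mk' Q))
      (R.map (QuotientGroup.mk' Q)) ?_ ?_ (hR.map _ hs) (hp.map _) ?_
    · exact ss_surj _ ((QuotientGroup.mk' Q).subgroupMap_surjective M) hM
    · rw [Subgroup.index_map_eq _ hs (by simpa using hQM)]; exact hMi
    · rw [← Subgroup.map_sup, hsup, Subgroup.map_top_of_surjective _ hs]

def HCLT (G : Type*) [Group G] : Prop :=
  ∀ H : Subgroup G, ∀ m : ℕ, m ∣ Nat.card H → ∃ K : Subgroup G, K ≤ H ∧ Nat.card K = m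

theorem HCLT.sub {G : Type*} [Group G] (h : HCLT G) (M : Subgroup G) : HCLT M := by
  intro H m hm
  obtain ⟨K, hK, hc⟩ := h (H.map M.subtype) m (by rwa [Subgroup.card_subtype])
  refine ⟨K.subgroupOf M, ?_, ?_⟩
  · have := Subgroup.comap_mono (f := M.subtype) hK
    rwa [Subgroup.comap_map_eq_self_of_injective M.subtype_injective] at this
  · rw [← Subgroup.card_subtype, Subgroup.map_subgroupOf_eq_of_le
      (hK.trans (Subgroup.map_subtype_le H)), hc]

theorem HCLT.index {G : Type*} [Group G] [Finite G] (h : HCLT G) {p : ℕ}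
    (hp : p ∣ Nat.card G) : ∃ M : Subgroup G, M.index = p := by
  obtain ⟨k, hk⟩ := hp
  obtain ⟨M, -, hM⟩ := h ⊤ k (by rw [Subgroup.card_top, hk]; exact dvd_mul_left k p)
  refine ⟨M, ?_⟩
  have h1 := M.card_mul_index
  have h0 : 0 < Nat.card M := Nat.card_pos
  rw [hk, hM, mul_comm p] at h1
  rw [hM] at h0
  exact Nat.eq_of_mul_eq_mul_left h0 h1

theorem HCLT.sylow.{u} (r : ℕ) [hr : Fact r.Prime] (n : ℕ) : ∀ (G : Type u) [Group G] [Finite G],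
    Nat.card G = n → HCLT G → (∀ q : ℕ, q.Prime → q ∣ Nat.card G → q ≤ r) →
    ∃ P : Sylow r G, (P : Subgroup G).Normal := by
  induction n using Nat.strong_induction_on with
  | _ n ih =>
  intro G _ _ hn h hmax
  by_cases h1 : Nat.card G = 1
  · refine ⟨default, ?_⟩
    have : Subsingleton G := (Nat.card_eq_one_iff_unique.1 h1).1
    rw [Subsingleton.elim ((default : Sylow r G) : Subgroup G) ⊤]
    infer_instance
  have hp := Nat.minFac_prime h1
  obtain ⟨M, hM⟩ := h.index (Nat.minFac_dvd (Nat.card G))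
  have hMn := Subgroup.normal_of_index_eq_minFac_card hM
  rcases (hmax _ hp (Nat.minFac_dvd _)).eq_or_lt with heq | hlt
  · -- `G` is an `r`-group
    have hG : IsPGroup r G := by
      rw [IsPGroup.iff_card]
      refine ⟨_, Nat.eq_prime_pow_of_unique_prime_dvd Nat.card_pos.ne' ?_⟩
      intro d hd hdd
      exact le_antisymm (hmax d hd hdd) (heq ▸ Nat.minFac_le_of_dvd hd.two_le hdd)
    refine ⟨default, ?_⟩
    have h2 : ((default : Sylow r G) : Subgroup G) = ⊤ :=
      ((default : Sylow r G).is_maximal' (hG.to_subgroup ⊤) le_top).symm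
    rw [h2]; infer_instance
  · have hcard := M.card_mul_index
    have hMlt : Nat.card M < n := by
      rw [← hn, ← hcard, hM]
      exact lt_mul_of_one_lt_right Nat.card_pos hp.one_lt
    obtain ⟨P, hP⟩ := ih _ hMlt M rfl (h.sub M)
      (fun q hq hqd => hmax q hq (hqd.trans M.card_subgroup_dvd_card))
    have hPc : (P : Subgroup M).Characteristic := P.characteristic_of_normal hP
    have hPi := P.not_dvd_index
    have hidx : ¬ r ∣ ((P : Subgroup M).map M.subtype).index := by
      rw [Subgroup.index_map_subtype, hr.out.dvd_mul, hM]
      rintro (h2 | h2)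
      · exact hPi h2
      · exact absurd (Nat.le_of_dvd hp.pos h2) (not_le.2 hlt)
    refine ⟨(P.isPGroup'.map M.subtype).toSylow hidx, ?_⟩
    rw [IsPGroup.toSylow_coe]
    infer_instance

theorem HCLT.ss.{u} (n : ℕ) : ∀ (G : Type u) [Group G] [Finite G],
    Nat.card G = n → HCLT G → IsSupersolvable G := by
  induction n using Nat.strong_induction_on with
  | _ n ih =>
  intro G _ _ hn h
  by_cases h1 : Nat.card G = 1
  · have : Subsingleton G := (Nat.card_eq_one_iff_unique.1 h1).1
    exact ⟨0, fun _ => ⊥, rfl, Subsingleton.elim _ _, fun _ => inferInstance,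
      fun i => i.elim0, fun i => i.elim0⟩
  have hne : (Nat.card G).primeFactors.Nonempty := by
    refine ⟨_, Nat.mem_primeFactors.2 ⟨Nat.minFac_prime h1, Nat.minFac_dvd _, Nat.card_pos.ne'⟩⟩
  let r := (Nat.card G).primeFactors.max' hne
  have hr := Nat.mem_primeFactors.1 ((Nat.card G).primeFactors.max'_mem hne)
  have hrp : Fact r.Prime := ⟨hr.1⟩
  obtain ⟨P, hP⟩ := HCLT.sylow r n G hn h (fun q hq hqd =>
    Finset.le_max' _ _ (Nat.mem_primeFactors.2 ⟨hq, hqd, Nat.card_pos.ne'⟩))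
  obtain ⟨M, hM⟩ := h.index hr.2.1
  have hM' : M.index = r := hM
  have hMp : M.index.Prime := hM'.symm ▸ hrp.out
  have hMlt : Nat.card M < n := by
    rw [← hn, ← M.card_mul_index]
    exact lt_mul_of_one_lt_right Nat.card_pos hMp.one_lt
  refine ss_of_sup r n G hn M P (ih _ hMlt M rfl (h.sub M)) hMp hP P.isPGroup' ?_
  apply eq_top_of_lt_of_index_prime hMp le_sup_left
  intro hle
  have h2 := Subgroup.index_dvd_of_le (le_sup_right.trans hle)
  rw [hM'] at h2
  exact P.not_dvd_index h2

theorem card_comap_mk {G : Type*} [Group G] [Finite G] (Q : Subgroup G) [Q.Normal]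
    (L : Subgroup (G ⧸ Q)) :
    Nat.card (L.comap (QuotientGroup.mk' Q)) = Nat.card Q * Nat.card L := by
  have h1 := (L.comap (QuotientGroup.mk' Q)).card_mul_index
  rw [Subgroup.index_comap_of_surjective _ (QuotientGroup.mk'_surjective Q),
    Subgroup.card_eq_card_quotient_mul_card_subgroup Q, ← L.card_mul_index] at h1
  have h0 : 0 < L.index := Nat.pos_of_ne_zero Subgroup.index_ne_zero_of_finite
  apply Nat.eq_of_mul_eq_mul_right h0
  rw [h1]; ring

theorem hclt_of_ss.{u} (n : ℕ) : ∀ (G : Type u) [Group G] [Finite G],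
    Nat.card G = n → IsSupersolvable G → HCLT G := by
  induction n using Nat.strong_induction_on with
  | _ n ih =>
  intro G _ _ hn h H m hm
  by_cases h1 : Nat.card G = 1
  · have h2 : Nat.card H = 1 := Nat.dvd_one.1 (h1 ▸ H.card_subgroup_dvd_card)
    exact ⟨H, le_rfl, by rw [h2] at hm ⊢; exact (Nat.dvd_one.1 hm).symm⟩
  have htop : (⊤ : Subgroup G) ≠ ⊥ := by
    intro h2
    apply h1
    rw [← Subgroup.card_top, h2, Subgroup.card_bot]
  obtain ⟨Q, -, hQn, hQp⟩ := ss_prime h ⊤ htop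
  have hs := QuotientGroup.mk'_surjective Q
  have hq := ih _ (hn ▸ card_quot_lt Q hQp) (G ⧸ Q) rfl (ss_surj _ hs h)
  by_cases hQH : Q ≤ H
  · have hcm : (H.map (QuotientGroup.mk' Q)).comap (QuotientGroup.mk' Q) = H := by
      rw [Subgroup.comap_map_eq, QuotientGroup.ker_mk', sup_eq_left.2 hQH]
    have hle : ∀ K : Subgroup (G ⧸ Q), K ≤ H.map (QuotientGroup.mk' Q) →
        K.comap (QuotientGroup.mk' Q) ≤ H := fun K hK => by
      have := Subgroup.comap_mono (f := QuotientGroup.mk' Q) hK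
      rwa [hcm] at this
    have hc := card_comap_mk Q (H.map (QuotientGroup.mk' Q))
    rw [hcm] at hc
    rw [hc] at hm
    by_cases hqm : Nat.card Q ∣ m
    · obtain ⟨k, rfl⟩ := hqm
      obtain ⟨K, hK, hKc⟩ := hq _ k (Nat.dvd_of_mul_dvd_mul_left hQp.pos hm)
      exact ⟨_, hle K hK, by rw [card_comap_mk, hKc]⟩
    · have hcop : Nat.Coprime (Nat.card Q) m := (Nat.Prime.coprime_iff_not_dvd hQp).2 hqm
      obtain ⟨K, hK, hKc⟩ := hq _ m (hcop.symm.dvd_of_dvd_mul_left hm)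
      let L := K.comap (QuotientGroup.mk' Q)
      have hLc : Nat.card L = Nat.card Q * m := by rw [card_comap_mk, hKc]
      have hQL : Q ≤ L := by
        have := Subgroup.comap_mono (f := QuotientGroup.mk' Q) (bot_le (a := K))
        rwa [MonoidHom.comap_bot, QuotientGroup.ker_mk'] at this
      have hQLc : Nat.card (Q.subgroupOf L) = Nat.card Q :=
        Nat.card_congr (Subgroup.subgroupOfEquivOfLe hQL).toEquiv
      have hQLi : (Q.subgroupOf L).index = m := by
        have := (Q.subgroupOf L).card_mul_index
        rw [hQLc, hLc] at this
        exact Nat.eq_of_mul_eq_mul_left hQp.pos this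
      obtain ⟨C, hC⟩ := Subgroup.exists_right_complement'_of_coprime (N := Q.subgroupOf L)
        (by rw [hQLc, hQLi]; exact hcop)
      refine ⟨C.map L.subtype, (Subgroup.map_subtype_le C).trans (hle K hK), ?_⟩
      rw [Subgroup.card_subtype, ← hC.symm.index_eq_card, hQLi]
  · let ψ := (QuotientGroup.mk' Q).comp H.subtype
    have hψ : Function.Injective ψ := by
      rw [← MonoidHom.ker_eq_bot_iff]
      have h3 : ψ.ker = Q.subgroupOf H := by
        rw [← MonoidHom.comap_ker, QuotientGroup.ker_mk']; rfl
      rw [h3, Subgroup.subgroupOf_eq_bot]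
      rw [disjoint_iff]
      rcases (Nat.dvd_prime hQp).1 (Subgroup.card_dvd_of_le (inf_le_left : Q ⊓ H ≤ Q)) with h4 | h4
      · exact Subgroup.card_eq_one.1 h4
      · exact absurd (inf_eq_left.1 (Subgroup.eq_of_le_of_card_ge inf_le_left h4.ge)) hQH
    have hrc : Nat.card ψ.range = Nat.card H :=
      (Nat.card_congr (MonoidHom.ofInjective hψ).toEquiv).symm
    obtain ⟨K, hK, hKc⟩ := hq ψ.range m (by rwa [hrc])
    refine ⟨(K.comap ψ).map H.subtype, Subgroup.map_subtype_le _, ?_⟩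
    rw [Subgroup.card_subtype, ← Subgroup.card_map_of_injective hψ,
      Subgroup.map_comap_eq_self hK, hKc]

/-- A finite group `G` is supersolvable if and only if every subgroup of `G` has the
property CLT: for every subgroup `H` of `G` and every divisor `m` of `|H|` there
exists a subgroup of `H` of order `m`. -/
theorem isSupersolvable_iff_all_subgroups_CLT (G : Type*) [Group G] [Finite G] :
    IsSupersolvable G ↔
      ∀ H : Subgroup G, ∀ m : ℕ, m ∣ Nat.card H →
        ∃ K : Subgroup G, K ≤ H ∧ Nat.card K = m :=
  ⟨hclt_of_ss _ G rfl, HCLT.ss _ G rfl⟩
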